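/- arXiv:1801.02860 — 6 statements merged into one kernel-verified Lean document; each statement's English description precedes it below -/
import Mathlib

section
/- For every n ≥ 1 and all indices i, j ∈ {0, 1, ..., 2^n − 1}, the (i, j) entry of the matrix G_N = F^{⊗n} over GF(2) equals 1 if and only if i binary-dominates j (i.e., every bit equal to 1 in the binary expansion of j is also equal to 1 in the binary expansion of i); otherwise the entry equals 0. -/
open Matrix

/-- The polar kernel `F = [[1,0],[1,1]]` over `GF(2)`. -/
def polarF : Matrix (Fin 2) (Fin 2) (ZMod 2) := !![1, 0; 1, 1]

/-- The `n`-fold Kronecker power `G_N = F^{⊗ n}` over `GF(2)`,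
indexed by `Fin (2 ^ n)` via the standard mixed-radix (binary) identification. -/
def polarG : (n : ℕ) → Matrix (Fin (2 ^ n)) (Fin (2 ^ n)) (ZMod 2)
  | 0 => 1
  | n + 1 =>
      Matrix.reindex
        (finProdFinEquiv.trans (finCongr (by rw [pow_succ, Nat.mul_comm])))
        (finProdFinEquiv.trans (finCongr (by rw [pow_succ, Nat.mul_comm])))
        (Matrix.kronecker polarF (polarG n))

/-- Binary domination `i ⪰ j` : every bit equal to 1 in `j` is also 1 in `i`. -/
def Dominates (i j : ℕ) : Prop := ∀ t : ℕ, j.testBit t = true → i.testBit t = true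

/-- `A` is domination-upward-closed. -/
def UpClosed {n : ℕ} (A : Finset (Fin (2 ^ n))) : Prop :=
  ∀ i ∈ A, ∀ j : Fin (2 ^ n), Dominates (j : ℕ) (i : ℕ) → j ∈ A

/-- The square submatrix `G_CC` of `G_N`, rows and columns indexed by the
elements of `C` listed in increasing order. -/
def subCC {n : ℕ} (C : Finset (Fin (2 ^ n))) :
    Matrix (Fin C.card) (Fin C.card) (ZMod 2) :=
  (polarG n).submatrix (⇑(C.orderEmbOfFin rfl)) (⇑(C.orderEmbOfFin rfl))

theorem dominates_two_pow_mul_add_iff {n a b c d : ℕ} (hb : b < 2 ^ n) (hd : d < 2 ^ n) :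
    Dominates (2 ^ n * a + b) (2 ^ n * c + d) ↔ Dominates a c ∧ Dominates b d := by
  simp only [Dominates, Nat.testBit_two_pow_mul_add _ hb, Nat.testBit_two_pow_mul_add _ hd]
  refine ⟨fun h => ⟨fun t ht => ?_, fun t ht => ?_⟩, fun h t => ?_⟩
  · simpa [ht] using h (n + t)
  · have htn : t < n := by
      by_contra! hle
      rw [Nat.testBit_lt_two_pow (hd.trans_le (Nat.pow_le_pow_right two_pos hle))] at ht
      exact Bool.false_ne_true ht
    simpa [htn, ht] using h t
  · split_ifs
    exacts [h.2 t, h.1 (t - n)]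

theorem polarF_eq_one_iff_dominates (a c : Fin 2) :
    polarF a c = 1 ↔ Dominates (a : ℕ) (c : ℕ) := by
  have h : ¬ Dominates 0 1 := fun h => by simpa using h 0
  fin_cases a <;> fin_cases c <;> simp [polarF, h] <;> simp [Dominates]

theorem zmod_two_mul_eq_one_iff (x y : ZMod 2) : x * y = 1 ↔ x = 1 ∧ y = 1 := by
  revert x y
  decide

theorem polarG_eq_one_iff_dominates (n : ℕ) (i j : Fin (2 ^ n)) :
    polarG n i j = 1 ↔ Dominates (i : ℕ) (j : ℕ) := by
  induction n with
  | zero =>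
    obtain rfl : i = j := Subsingleton.elim (α := Fin 1) i j
    simp [polarG, Dominates]
  | succ n ih =>
    let e : Fin 2 × Fin (2 ^ n) ≃ Fin (2 ^ (n + 1)) :=
      finProdFinEquiv.trans (finCongr (by rw [pow_succ, Nat.mul_comm]))
    obtain ⟨⟨a, b⟩, rfl⟩ := e.surjective i
    obtain ⟨⟨c, d⟩, rfl⟩ := e.surjective j
    have hval (x : Fin 2) (y : Fin (2 ^ n)) : (e (x, y) : ℕ) = 2 ^ n * x + y := by
      simp [e, add_comm]
    have hentry : polarG (n + 1) (e (a, b)) (e (c, d)) = polarF a c * polarG n b d := by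
      change Matrix.reindex e e (Matrix.kronecker polarF (polarG n)) _ _ = _
      simp
    rw [hentry, hval, hval, dominates_two_pow_mul_add_iff b.isLt d.isLt,
      zmod_two_mul_eq_one_iff, polarF_eq_one_iff_dominates, ih]

/-- the `(i,j)` entry of `G_N = F^{⊗n}` is 1 iff `i` binary-dominates `j`,
and is 0 otherwise. -/
theorem polarG_entry_eq_one_iff_dominates (n : ℕ) (hn : 1 ≤ n) (i j : Fin (2 ^ n)) :
    (polarG n i j = 1 ↔ Dominates (i : ℕ) (j : ℕ)) ∧
    (¬ Dominates (i : ℕ) (j : ℕ) → polarG n i j = 0) := by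
  have h := polarG_eq_one_iff_dominates n i j
  refine ⟨h, fun hij => ?_⟩
  have zero_of_ne_one : ∀ x : ZMod 2, x ≠ 1 → x = 0 := by decide
  exact zero_of_ne_one _ (mt h.mp hij)
end

section
/- (Proposition 1) Let A ⊆ {0, 1, ..., 2^n − 1} be domination-upward-closed. Then the submatrix G_ĀA of G_N = F^{⊗n}, with rows indexed by the complement Ā of A and columns indexed by A, is the zero matrix: every entry G_{i',i} of G_N with i' ∉ A and i ∈ A equals 0. -/
open Matrix

theorem Dominates.two_pow_mul_add {n a b c d : ℕ} (hb : b < 2 ^ n) (hd : d < 2 ^ n)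
    (hac : Dominates a c) (hbd : Dominates b d) :
    Dominates (2 ^ n * a + b) (2 ^ n * c + d) := by
  intro t
  rw [Nat.testBit_two_pow_mul_add c hd, Nat.testBit_two_pow_mul_add a hb]
  split_ifs
  · exact hbd t
  · exact hac _

theorem dominates_of_polarF_ne_zero {a c : Fin 2} (h : polarF a c ≠ 0) :
    Dominates (a : ℕ) (c : ℕ) := by
  intro t
  fin_cases a <;> fin_cases c <;> simp_all [polarF]

theorem dominates_of_polarG_ne_zero {n : ℕ} {i j : Fin (2 ^ n)} (h : polarG n i j ≠ 0) :
    Dominates (i : ℕ) (j : ℕ) := by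
  induction n with
  | zero =>
    intro t
    simp
  | succ n ih =>
    simp only [polarG, Matrix.reindex_apply, Matrix.submatrix_apply, Matrix.kronecker,
      Matrix.kroneckerMap_apply] at h
    have key := Dominates.two_pow_mul_add (Fin.isLt _) (Fin.isLt _)
      (dominates_of_polarF_ne_zero (left_ne_zero_of_mul h)) (ih (right_ne_zero_of_mul h))
    simpa [Nat.div_add_mod] using key

/-- Proposition 1: if `A` is domination-upward-closed then `G_ĀA = 0`. -/
theorem polarG_compl_rows_zero (n : ℕ) (hn : 1 ≤ n) (A : Finset (Fin (2 ^ n)))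
    (hA : UpClosed A) :
    ∀ i' : Fin (2 ^ n), i' ∉ A → ∀ i ∈ A, polarG n i' i = 0 := by
  intro i' hi' i hi
  by_contra h
  exact hi' (hA i hi i' (dominates_of_polarG_ne_zero h))
end

section
/- (Lemma 1, Section IV-B) Let C ⊆ {0, 1, ..., 2^n − 1} and suppose the submatrix G_C̄C of G_N = F^{⊗n} (rows indexed by the complement C̄ of C, columns indexed by C) is the zero matrix. Then G_CC · G_CC = I over GF(2), i.e., the submatrix G_CC equals its own inverse. -/
open Matrix

theorem polarF_mul_self : polarF * polarF = 1 := by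
  decide

theorem polarG_mul_self (n : ℕ) : polarG n * polarG n = 1 := by
  induction n with
  | zero => simp [polarG]
  | succ n ih =>
    simp only [polarG, Matrix.reindex_apply, Matrix.submatrix_mul_equiv, Matrix.kronecker]
    rw [← Matrix.mul_kronecker_mul, polarF_mul_self, ih, Matrix.one_kronecker_one,
      Matrix.submatrix_one_equiv]

/-- Lemma 1: if `G_C̄C = 0` then `G_CC` is its own inverse. -/
theorem subCC_involution_of_compl_zero (n : ℕ) (hn : 1 ≤ n) (C : Finset (Fin (2 ^ n)))
    (hzero : ∀ i' : Fin (2 ^ n), i' ∉ C → ∀ i ∈ C, polarG n i' i = 0) :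
    subCC C * subCC C = 1 := by
  ext a b
  have hentry : (polarG n * polarG n) (C.orderEmbOfFin rfl a) (C.orderEmbOfFin rfl b) =
      (1 : Matrix (Fin C.card) (Fin C.card) (ZMod 2)) a b := by
    simp [polarG_mul_self, Matrix.one_apply]
  rw [← hentry, Matrix.mul_apply, Matrix.mul_apply]
  have hsum (f : Fin (2 ^ n) → ZMod 2) :
      ∑ k, f (C.orderEmbOfFin rfl k) = ∑ k ∈ C, f k := by
    conv_rhs => rw [← Finset.map_orderEmbOfFin_univ C rfl]
    rw [Finset.sum_map]
    rfl
  calc ∑ k, subCC C a k * subCC C k b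
      = ∑ k ∈ C, polarG n (C.orderEmbOfFin rfl a) k * polarG n k (C.orderEmbOfFin rfl b) :=
        hsum fun k => polarG n (C.orderEmbOfFin rfl a) k * polarG n k (C.orderEmbOfFin rfl b)
    _ = _ := Finset.sum_subset (Finset.subset_univ C) fun k _ hk => by
        rw [hzero k hk _ (C.orderEmbOfFin_mem rfl b), mul_zero]
end

section
/- (Proposition 3, Uneven Pilot Selection) Let A ⊆ {0, 1, ..., 2^n − 1} be domination-upward-closed, let S = { j ∈ Ā : the column of G_N indexed by j, restricted to the rows indexed by Ā, has exactly one nonzero entry (namely the entry in row j) }, and let P_f ⊆ S. Then for C = A ∪ P_f, the submatrix G_C̄C of G_N = F^{⊗n} is the zero matrix. -/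
open Matrix

/-- Proposition 3, UEPS: with `A` domination-upward-closed,
`S` the set of columns of `G_N` in `Ā` whose restriction to rows `Ā` has exactly one
nonzero entry (in row `j` itself), and `P_f ⊆ S`, the submatrix `G_C̄C` with
`C = A ∪ P_f` is zero. -/
theorem UEPS_compl_zero (n : ℕ) (hn : 1 ≤ n)
    (A S Pf : Finset (Fin (2 ^ n))) (hA : UpClosed A)
    (hS : ∀ j : Fin (2 ^ n),
      j ∈ S ↔ (j ∈ Aᶜ ∧ ∀ i ∈ Aᶜ, (polarG n i j ≠ 0 ↔ i = j)))
    (hPf : Pf ⊆ S) :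
    ∀ i' : Fin (2 ^ n), i' ∉ A ∪ Pf → ∀ i ∈ A ∪ Pf, polarG n i' i = 0 := by
  intro i' hi' i hi
  rw [Finset.mem_union, not_or] at hi'
  by_contra h
  rcases Finset.mem_union.mp hi with hiA | hiP
  · exact hi'.1 (hA i hiA i' (dominates_of_polarG_ne_zero h))
  · have hcol := ((hS i).mp (hPf hiP)).2 i' (Finset.mem_compl.mpr hi'.1)
    exact hi'.2 (hcol.mp h ▸ hiP)
end

section
/- (Proposition 4) Let A ⊆ {0, 1, ..., 2^n − 1} be domination-upward-closed, let S = { j ∈ Ā : the column of G_N indexed by j, restricted to the rows indexed by Ā, has exactly one nonzero entry (namely the entry in row j) }, and let P_f ⊆ S. Then the set C = A ∪ P_f is domination contiguous: for all h, j ∈ C and all i ∈ {0, ..., N−1}, if h ⪰ i and i ⪰ j then i ∈ C. -/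
open Matrix

theorem Dominates.mod_two_pow {i j : ℕ} (h : Dominates i j) (n : ℕ) :
    Dominates (i % 2 ^ n) (j % 2 ^ n) := by
  intro t ht
  simp only [Nat.testBit_mod_two_pow, Bool.and_eq_true] at ht ⊢
  exact ⟨ht.1, h t ht.2⟩

theorem Dominates.div_two_pow {i j : ℕ} (h : Dominates i j) (n : ℕ) :
    Dominates (i / 2 ^ n) (j / 2 ^ n) := by
  intro t ht
  simp only [Nat.testBit_div_two_pow] at ht ⊢
  exact h _ ht

theorem polarF_ne_zero_of_dominates {i j : Fin 2} (h : Dominates (i : ℕ) (j : ℕ)) :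
    polarF i j ≠ 0 := by
  have h₀ := h 0
  fin_cases i <;> fin_cases j <;> simp_all [polarF]

theorem polarG_ne_zero_of_dominates {n : ℕ} {i j : Fin (2 ^ n)}
    (h : Dominates (i : ℕ) (j : ℕ)) : polarG n i j ≠ 0 := by
  induction n with
  | zero =>
    rw [show i = j from Fin.ext (by omega)]
    simp [polarG]
  | succ n ih =>
    simp only [polarG, Matrix.reindex_apply, Matrix.submatrix_apply, Matrix.kronecker,
      Matrix.kroneckerMap_apply]
    refine mul_ne_zero (polarF_ne_zero_of_dominates ?_) (ih ?_)
    · exact h.div_two_pow n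
    · exact h.mod_two_pow n

/-- Proposition 4: under the UEPS selection, `C = A ∪ P_f` is
domination contiguous. -/
theorem UEPS_domination_contiguous (n : ℕ) (hn : 1 ≤ n)
    (A S Pf : Finset (Fin (2 ^ n))) (hA : UpClosed A)
    (hS : ∀ j : Fin (2 ^ n),
      j ∈ S ↔ (j ∈ Aᶜ ∧ ∀ i ∈ Aᶜ, (polarG n i j ≠ 0 ↔ i = j)))
    (hPf : Pf ⊆ S) :
    ∀ h ∈ A ∪ Pf, ∀ j ∈ A ∪ Pf, ∀ i : Fin (2 ^ n),
      Dominates (h : ℕ) (i : ℕ) → Dominates (i : ℕ) (j : ℕ) → i ∈ A ∪ Pf := by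
  intro h _ j hj i _ hij
  by_cases hi : i ∈ A
  · exact Finset.mem_union_left _ hi
  · have hjP : j ∈ Pf := (Finset.mem_union.1 hj).resolve_left fun hjA => hi (hA j hjA i hij)
    have hi_eq : i = j :=
      (((hS j).1 (hPf hjP)).2 i (Finset.mem_compl.2 hi)).1 (polarG_ne_zero_of_dominates hij)
    exact Finset.mem_union_right _ (hi_eq ▸ hjP)
end

section
/- (Proposition 5) Let n ≥ 2, N = 2^n, and let D = { i ∈ {0, ..., N−1} : i ≡ 3 (mod 4) } (the indices whose two lowest binary digits are both 1, i.e., the multiples of four in 1-based indexing). Then the submatrix G_D̄D of G_N = F^{⊗n}, with rows indexed by the complement D̄ of D and columns indexed by D, is the zero matrix. -/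
open Matrix

theorem polarF_eq_zero_of_lt {a b : Fin 2} (h : a < b) : polarF a b = 0 := by
  obtain ⟨rfl, rfl⟩ : a = 0 ∧ b = 1 := by omega
  rfl

theorem polarG_succ_apply (n : ℕ) (i j : Fin (2 ^ (n + 1))) :
    ∃ (a b : Fin 2) (k l : Fin (2 ^ n)),
      (a : ℕ) = i / 2 ^ n ∧ (b : ℕ) = j / 2 ^ n ∧ (k : ℕ) = i % 2 ^ n ∧ (l : ℕ) = j % 2 ^ n ∧
        polarG (n + 1) i j = polarF a b * polarG n k l :=
  ⟨_, _, _, _, rfl, rfl, rfl, rfl, rfl⟩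

theorem dominates_of_div_le_of_mod {n i j : ℕ} (hj : j < 2 ^ (n + 1)) (hi : i < 2 ^ (n + 1))
    (hdiv : j / 2 ^ n ≤ i / 2 ^ n) (hmod : Dominates (i % 2 ^ n) (j % 2 ^ n)) :
    Dominates i j := by
  intro t ht
  rcases lt_trichotomy t n with h | rfl | h
  · simpa [Nat.testBit_mod_two_pow, h, ht] using hmod t
  · have hlt : i / 2 ^ t < 2 := Nat.div_lt_of_lt_mul (by rwa [← pow_succ])
    simp only [Nat.testBit_eq_decide_div_mod_eq, decide_eq_true_eq] at ht ⊢
    have := Nat.mod_le (j / 2 ^ t) 2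
    omega
  · have := Nat.testBit_lt_two_pow (hj.trans_le (Nat.pow_le_pow_right two_pos h))
    simp_all

theorem Dominates.mod_four_eq_three {i j : ℕ} (h : Dominates i j) (hj : j % 4 = 3) :
    i % 4 = 3 := by
  have h0 := h 0
  have h1 := h 1
  simp only [Nat.testBit_eq_decide_div_mod_eq, decide_eq_true_eq, pow_zero, pow_one] at h0 h1
  omega

/-- Proposition 5: with `D = {i : i ≡ 3 (mod 4)}`, the submatrix
`G_D̄D` of `G_N = F^{⊗n}` is zero. -/
theorem polarG_multiple_of_four_columns_zero (n : ℕ) (hn : 2 ≤ n) :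
    ∀ i' ∈ (Finset.univ.filter (fun i : Fin (2 ^ n) => (i : ℕ) % 4 = 3))ᶜ,
      ∀ j ∈ Finset.univ.filter (fun i : Fin (2 ^ n) => (i : ℕ) % 4 = 3),
        polarG n i' j = 0 := by
  intro i' hi j hj
  simp only [Finset.mem_compl, Finset.mem_filter, Finset.mem_univ, true_and] at hi hj
  by_contra h
  exact hi ((dominates_of_polarG_ne_zero h).mod_four_eq_three hj)
end
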